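/- Let V₆ be a 6-dimensional vector space and A ⊆ Λ³V₆ a Lagrangian subspace for the wedge-product symplectic form. Under the canonical isomorphism Gr(3,V₆) ≅ Gr(3,V₆^∨) sending V₃ to its annihilator V₃^⊥, the condition A ∩ (V₆ ∧ Λ²V₃) ≠ 0 is equivalent to A^⊥ ∩ (V₆^∨ ∧ Λ²(V₃^⊥)) ≠ 0. More precisely, the isomorphism Λ³V₆ → Λ³(V₆^∨) induced by the symplectic form maps the subspace V₆ ∧ Λ²V₃ onto V₆^∨ ∧ Λ²(V₃^⊥). -/

import Mathlib

open ExteriorAlgebra Module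

lemma aux_prod3 {k V : Type*} [Field k] [AddCommGroup V] [Module k V] (v : Fin 3 → V) :
    ιMulti k 3 v = ι k (v 0) * ι k (v 1) * ι k (v 2) := by
  simp only [ιMulti_apply, List.ofFn_succ, List.ofFn_zero, List.prod_cons, List.prod_nil, mul_one,
    mul_assoc]
  rfl

lemma aux_nondeg {k V : Type*} [Field k] [AddCommGroup V] [Module k V]
    (b : Basis (Fin 6) k V)
    (P : ExteriorAlgebra k V →ₗ[k] ExteriorAlgebra k (Module.Dual k V) →ₗ[k] k)
    (hP : ∀ (v : Fin 3 → V) (f : Fin 3 → Module.Dual k V),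
      P (ιMulti k 3 v) (ιMulti k 3 f) = Matrix.det (Matrix.of fun i j => f i (v j)))
    (η : ExteriorAlgebra k (Module.Dual k V)) (hη : η ∈ ⋀[k]^3 (Module.Dual k V))
    (h : ∀ v : Fin 3 → V, P (ιMulti k 3 v) η = 0) : η = 0 := by
  have key : ∀ s, ((P (ιMulti_family k 3 b s)).comp (Submodule.subtype (⋀[k]^3 (Module.Dual k V)))) =
      (b.dualBasis.exteriorPower 3).coord s := by
    intro s
    apply (b.dualBasis.exteriorPower 3).ext
    intro t
    have e1 : ∀ s t : Set.powersetCard (Fin 6) 3, (P (ιMulti_family k 3 b s)) (ιMulti_family k 3 b.dualBasis t) =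
        exteriorPower.ιMultiDual k 3 b t (exteriorPower.ιMulti_family k 3 b s) := by
      intro s t
      rw [exteriorPower.ιMulti_family, exteriorPower.ιMultiDual_apply_ιMulti, hP,
        ← Matrix.det_transpose]
      congr 1
      ext i j
      simp
    rw [exteriorPower.basis_apply, Basis.coord_apply]
    rw [LinearMap.comp_apply, Submodule.subtype_apply, exteriorPower.ιMulti_family_apply_coe, e1]
    rcases eq_or_ne t s with rfl | hne
    · rw [exteriorPower.ιMultiDual_apply_diag, exteriorPower.basis_repr_self]
    · rw [exteriorPower.ιMultiDual_apply_nondiag k 3 b _ _ hne, exteriorPower.basis_repr_ne _ _ _ hne]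
  have : (⟨η, hη⟩ : ⋀[k]^3 (Module.Dual k V)) = 0 := by
    apply (b.dualBasis.exteriorPower 3).ext_elem
    intro s
    rw [← Basis.coord_apply, ← key]
    rw [map_zero]
    exact h _
  simpa using congrArg Subtype.val this

lemma aux_top {k V : Type*} [Field k] [AddCommGroup V] [Module k V]
    (b : Basis (Fin 6) k V) : ιMulti k 6 b ≠ 0 := by
  intro h
  have h1 := exteriorPower.ιMultiDual_apply_ιMulti k 6 b
    (Set.powersetCard.ofFinEmbEquiv (RelEmbedding.refl _)) b
  have h2 : exteriorPower.ιMulti k 6 b = 0 := by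
    apply Subtype.ext; simpa using h
  rw [h2] at h1
  have h3 : (Matrix.of fun i j => b.coord ((Set.powersetCard.ofFinEmbEquiv.symm
    (Set.powersetCard.ofFinEmbEquiv (RelEmbedding.refl (α := Fin 6) (· ≤ ·)))) j) (b i)) = 1 := by
    ext i j
    simp [Matrix.one_apply, Finsupp.single_apply]
  rw [h3] at h1
  simp at h1

lemma aux_gbasis {k V : Type*} [Field k] [AddCommGroup V] [Module k V]
    (b : Basis (Fin 6) k V)
    (φ : ExteriorAlgebra k V →ₗ[k] k)
    (P : ExteriorAlgebra k V →ₗ[k] ExteriorAlgebra k (Module.Dual k V) →ₗ[k] k)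
    (hP : ∀ (v : Fin 3 → V) (f : Fin 3 → Module.Dual k V),
      P (ιMulti k 3 v) (ιMulti k 3 f) = Matrix.det (Matrix.of fun i j => f i (v j)))
    (g : ExteriorAlgebra k V →ₗ[k] ExteriorAlgebra k (Module.Dual k V))
    (hg : ∀ ξ ∈ ⋀[k]^3 V, g ξ ∈ ⋀[k]^3 (Module.Dual k V) ∧
      ∀ η ∈ ⋀[k]^3 V, P η (g ξ) = φ (ξ * η)) :
    g (ιMulti k 3 (b ∘ Fin.castAdd 3)) =
      φ (ιMulti k 6 b) • ιMulti k 3 (b.coord ∘ Fin.natAdd 3) := by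
  have mem : ∀ v : Fin 3 → V, ιMulti k 3 v ∈ ⋀[k]^3 V := fun v => ιMulti_range k 3 ⟨v, rfl⟩
  have mem' : ∀ v : Fin 3 → Dual k V, ιMulti k 3 v ∈ ⋀[k]^3 (Dual k V) :=
    fun v => ιMulti_range k 3 ⟨v, rfl⟩
  set c := φ (ιMulti k 6 b) with hc
  let M : V [⋀^Fin 3]→ₗ[k] k :=
    (φ.comp (LinearMap.mulLeft k (ιMulti k 3 (b ∘ Fin.castAdd 3)))).compAlternatingMap (ιMulti k 3)
  let M' : V [⋀^Fin 3]→ₗ[k] k :=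
    (c • P.flip (ιMulti k 3 (b.coord ∘ Fin.natAdd 3))).compAlternatingMap (ιMulti k 3)
  have hM : ∀ v, M v = φ (ιMulti k 3 (b ∘ Fin.castAdd 3) * ιMulti k 3 v) := fun v => rfl
  have hM' : ∀ v, M' v = c * Matrix.det (Matrix.of fun i j => (b.coord (Fin.natAdd 3 i)) (v j)) := by
    intro v
    rw [← hP v (fun i => b.coord (Fin.natAdd 3 i))]; rfl
  have hMM : M = M' := by
    apply Basis.ext_alternating b
    intro s hs
    by_cases h : ∃ j, s j < 3
    · obtain ⟨j, hj⟩ := h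
      have hz : M' (fun i => b (s i)) = 0 := by
        rw [hM', Matrix.det_eq_zero_of_column_eq_zero j, mul_zero]
        intro i
        simp only [Matrix.of_apply, Basis.coord_apply, Basis.repr_self]
        apply Finsupp.single_eq_of_ne
        intro h
        rw [← h] at hj
        simp [Fin.lt_def] at hj
      rw [hz, hM, ιMulti_mul_ιMulti, ιMulti_eq_zero_of_not_inj, map_zero]
      intro hinj
      have : Fin.castAdd 3 (⟨s j, hj⟩ : Fin 3) = Fin.natAdd 3 j := by
        apply hinj
        rw [Fin.append_left, Fin.append_right]
        rfl
      simp [Fin.ext_iff] at this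
      have := j.2
      have : (s j).1 < 3 := hj
      omega
    · push Not at h
      let τ : Fin 3 → Fin 3 := fun j => ⟨s j - 3, by have := (s j).2; omega⟩
      have hτs : ∀ j, s j = Fin.natAdd 3 (τ j) := by
        intro j
        have : 3 ≤ (s j).1 := h j
        ext; simp [τ]; omega
      have hτ : Function.Injective τ := by
        intro i j hij
        apply hs
        rw [hτs, hτs, hij]
      let σ : Equiv.Perm (Fin 3) := Equiv.ofBijective τ (Finite.injective_iff_bijective.mp hτ)
      have hs' : (fun i => b (s i)) = (b ∘ Fin.natAdd 3) ∘ σ := by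
        funext i; simp [hτs, σ]
      rw [hs', AlternatingMap.map_perm, AlternatingMap.map_perm]
      congr 1
      rw [hM, hM', ιMulti_mul_ιMulti]
      have h1 : (Matrix.of fun i j => (b.coord (Fin.natAdd 3 i)) ((b ∘ Fin.natAdd 3) j)) =
          (1 : Matrix (Fin 3) (Fin 3) k) := by
        ext i j
        rw [Matrix.one_apply, Matrix.of_apply, Function.comp_apply, Basis.coord_apply,
          Basis.repr_self, Finsupp.single_apply]
        have hij : (Fin.natAdd 3 j : Fin 6) = Fin.natAdd 3 i ↔ i = j := by
          simp only [Fin.ext_iff, Fin.val_natAdd]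
          omega
        by_cases hc : i = j
        · rw [if_pos hc, if_pos (hij.mpr hc)]
        · rw [if_neg hc, if_neg (fun h => hc (hij.mp h))]
      rw [h1, Matrix.det_one, mul_one, hc]
      have h2 : Fin.append (b ∘ Fin.castAdd 3 : Fin 3 → V) (b ∘ Fin.natAdd 3 : Fin 3 → V) = (b : Fin 6 → V) := by
        funext i
        refine Fin.addCases (m := 3) (n := 3) (fun i => ?_) (fun i => ?_) i
        · rw [Fin.append_left]; rfl
        · rw [Fin.append_right]; rfl
      exact congrArg (fun u => φ (ιMulti k 6 u)) h2
  rw [← sub_eq_zero]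
  apply aux_nondeg b P hP
  · exact sub_mem (hg _ (mem _)).1 (Submodule.smul_mem _ _ (mem' _))
  · intro v
    rw [map_sub, (hg _ (mem _)).2 _ (mem _), map_smul, sub_eq_zero]
    exact congrArg (fun N : V [⋀^Fin 3]→ₗ[k] k => N v) hMM

lemma aux_gperm {k V : Type*} [Field k] [AddCommGroup V] [Module k V]
    (b : Basis (Fin 6) k V)
    (φ : ExteriorAlgebra k V →ₗ[k] k)
    (hφ : ∀ x ∈ ⋀[k]^6 V, φ x = 0 → x = 0)
    (P : ExteriorAlgebra k V →ₗ[k] ExteriorAlgebra k (Module.Dual k V) →ₗ[k] k)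
    (hP : ∀ (v : Fin 3 → V) (f : Fin 3 → Module.Dual k V),
      P (ιMulti k 3 v) (ιMulti k 3 f) = Matrix.det (Matrix.of fun i j => f i (v j)))
    (g : ExteriorAlgebra k V →ₗ[k] ExteriorAlgebra k (Module.Dual k V))
    (hg : ∀ ξ ∈ ⋀[k]^3 V, g ξ ∈ ⋀[k]^3 (Module.Dual k V) ∧
      ∀ η ∈ ⋀[k]^3 V, P η (g ξ) = φ (ξ * η))
    (s : Fin 6 → Fin 6) (hs : Function.Injective s) :
    ∃ c : k, c ≠ 0 ∧ g (ι k (b (s 0)) * (ι k (b (s 1)) * ι k (b (s 2)))) =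
      c • (ι k (b.coord (s 3)) * (ι k (b.coord (s 4)) * ι k (b.coord (s 5)))) := by
  let σ : Equiv.Perm (Fin 6) := Equiv.ofBijective s (Finite.injective_iff_bijective.mp hs)
  have := aux_gbasis (b.reindex σ.symm) φ P hP g hg
  rw [aux_prod3, aux_prod3] at this
  refine ⟨φ (ιMulti k 6 (b.reindex σ.symm)), ?_, ?_⟩
  · intro h
    exact aux_top _ (hφ _ (ιMulti_range k 6 ⟨_, rfl⟩) h)
  · have hc : ∀ i, (b.reindex σ.symm).coord i = b.coord (s i) := by
      intro i; ext v; simp [σ]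
    simp only [Function.comp_apply, hc, Basis.reindex_apply, Equiv.symm_symm] at this
    rw [← mul_assoc, ← mul_assoc]
    exact this

lemma aux_inj (a b c d e f : Fin 6) (h : [a, b, c, d, e, f].Nodup) :
    Function.Injective ![a, b, c, d, e, f] := by
  have h' := List.nodup_iff_injective_get.mp h
  intro i j hij
  apply h'
  fin_cases i <;> fin_cases j <;> exact hij

set_option synthInstance.maxSize 2000 in
set_option synthInstance.maxHeartbeats 400000 in
lemma aux_comb0 : ∀ i j l : Fin 6, i ≠ j → i ≠ l → j ≠ l →
    ∃ x : Fin 6, x ≠ i ∧ x ≠ j ∧ x ≠ l ∧ ∃ y : Fin 6, y ≠ x ∧ y ≠ i ∧ y ≠ j ∧ y ≠ l ∧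
      (j < 3 → l < 3 → 3 ≤ y) ∧ (3 ≤ j → 3 ≤ l → y < 3) ∧
    ∃ z : Fin 6, z ≠ x ∧ z ≠ y ∧ z ≠ i ∧ z ≠ j ∧ z ≠ l ∧
      (j < 3 → l < 3 → 3 ≤ z) ∧ (3 ≤ j → 3 ≤ l → z < 3) := by
  decide +kernel

lemma aux_comb (i j l : Fin 6) (hij : i ≠ j) (hil : i ≠ l) (hjl : j ≠ l) :
    ∃ x y z : Fin 6, Function.Injective ![x, y, z, i, j, l] ∧
      Function.Injective ![i, j, l, x, y, z] ∧
      (j < 3 → l < 3 → 3 ≤ y ∧ 3 ≤ z) ∧ (3 ≤ j → 3 ≤ l → y < 3 ∧ z < 3) := by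
  obtain ⟨x, h1, h2, h3, y, h4, h5, h6, h7, h8, h9, z, g1, g2, g3, g4, g5, g6, g7⟩ :=
    aux_comb0 i j l hij hil hjl
  refine ⟨x, y, z, aux_inj _ _ _ _ _ _ ?_, aux_inj _ _ _ _ _ _ ?_,
    fun a b => ⟨h8 a b, g6 a b⟩, fun a b => ⟨h9 a b, g7 a b⟩⟩
  · simp only [List.nodup_cons, List.mem_cons, List.not_mem_nil, or_false, not_or]
    simp [*, Ne.symm h4, Ne.symm g1, Ne.symm g2]
  · simp only [List.nodup_cons, List.mem_cons, List.not_mem_nil, or_false, not_or]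
    simp [*, Ne.symm h1, Ne.symm h2, Ne.symm h3, Ne.symm h4, Ne.symm h5, Ne.symm h6, Ne.symm h7,
      Ne.symm g1, Ne.symm g2, Ne.symm g3, Ne.symm g4, Ne.symm g5]

lemma aux_basis {k V : Type*} [Field k] [AddCommGroup V] [Module k V] [FiniteDimensional k V]
    (h6 : Module.finrank k V = 6) (W : Submodule k V) (h3 : Module.finrank k W = 3) :
    ∃ b : Basis (Fin 6) k V, W = Submodule.span k (b '' {i | i < 3}) ∧
      W.dualAnnihilator = Submodule.span k (b.coord '' {i | 3 ≤ i}) := by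
  have hq : finrank k (V ⧸ W) = 3 := by
    have := W.finrank_quotient_add_finrank
    omega
  let bW := finBasisOfFinrankEq k W h3
  let bQ := finBasisOfFinrankEq k (V ⧸ W) hq
  let b : Basis (Fin 6) k V := (Basis.sumQuot bW bQ).reindex finSumFinEquiv
  have hb : ∀ i : Fin 3, b (Fin.castAdd 3 i) = bW i := by
    intro i
    have : (Fin.castAdd 3 i : Fin (3+3)) = finSumFinEquiv (Sum.inl i) := rfl
    simp only [b, this]
    rw [Basis.reindex_apply, Equiv.symm_apply_apply, Basis.sumQuot_inl]
  have hset : b '' {i | i < 3} = W.subtype '' (Set.range bW) := by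
    ext x
    constructor
    · rintro ⟨i, hi, rfl⟩
      exact ⟨bW ⟨i, hi⟩, ⟨_, rfl⟩, (hb ⟨i, hi⟩).symm⟩
    · rintro ⟨_, ⟨i, rfl⟩, rfl⟩
      exact ⟨Fin.castAdd 3 i, i.2, hb i⟩
  have hW : W = Submodule.span k (b '' {i | i < 3}) := by
    rw [hset, ← Submodule.map_span, bW.span_eq, Submodule.map_top, Submodule.range_subtype]
  refine ⟨b, hW, ?_⟩
  apply le_antisymm
  · intro f hf
    rw [Submodule.mem_dualAnnihilator] at hf
    rw [← b.sum_dual_apply_smul_coord f]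
    apply Submodule.sum_mem
    intro i _
    by_cases hi : 3 ≤ i
    · exact Submodule.smul_mem _ _ (Submodule.subset_span ⟨i, hi, rfl⟩)
    · rw [hf (b i), zero_smul]
      · exact zero_mem _
      · rw [hW]
        exact Submodule.subset_span ⟨i, not_le.mp hi, rfl⟩
  · rw [Submodule.span_le]
    rintro _ ⟨i, hi, rfl⟩
    rw [SetLike.mem_coe, Submodule.mem_dualAnnihilator]
    intro w hw
    rw [hW] at hw
    have : Submodule.span k (b '' {i | i < 3}) ≤ LinearMap.ker (b.coord i) := by
      rw [Submodule.span_le]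
      rintro _ ⟨j, hj, rfl⟩
      have hne : i ≠ j := by
        rintro rfl
        exact (not_lt.mpr (show 3 ≤ i from hi)) hj
      simp [hne.symm]
    exact this hw

open Pointwise in
lemma aux_span {k V : Type*} [Field k] [AddCommGroup V] [Module k V] (b : Fin 6 → V)
    (hb : Submodule.span k (Set.range b) = ⊤) (W : Submodule k V) (p : Fin 6 → Prop)
    (hW : W = Submodule.span k (b '' {i | p i})) :
    (LinearMap.range (ι k (M := V))) * (LinearMap.range ((ι k).comp W.subtype)) ^ 2
     = Submodule.span k {x | ∃ i j l, p j ∧ p l ∧ x = ι k (b i) * (ι k (b j) * ι k (b l))} := by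
  rw [LinearMap.range_comp, Submodule.range_subtype, LinearMap.range_eq_map, ← hb, hW,
    Submodule.map_span, Submodule.map_span, pow_two, Submodule.span_mul_span,
    Submodule.span_mul_span]
  congr 1
  ext x
  constructor
  · rintro ⟨_, ⟨_, ⟨i, rfl⟩, rfl⟩, _, ⟨_, ⟨_, ⟨j, hj, rfl⟩, rfl⟩, _, ⟨_, ⟨l, hl, rfl⟩, rfl⟩, rfl⟩, rfl⟩
    exact ⟨i, j, l, hj, hl, rfl⟩
  · rintro ⟨i, j, l, hj, hl, rfl⟩
    exact ⟨_, ⟨_, ⟨i, rfl⟩, rfl⟩, _, ⟨_, ⟨_, ⟨j, hj, rfl⟩, rfl⟩, _, ⟨_, ⟨l, hl, rfl⟩, rfl⟩, rfl⟩, rfl⟩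

lemma aux_span3 {k V : Type*} [Field k] [AddCommGroup V] [Module k V] (b : Fin 6 → V)
    (hb : Submodule.span k (Set.range b) = ⊤) :
    ⋀[k]^3 V = Submodule.span k
      {x | ∃ i j l, True ∧ True ∧ x = ι k (b i) * (ι k (b j) * ι k (b l))} := by
  rw [← aux_span b hb ⊤ (fun _ => True) (by simp [hb])]
  rw [LinearMap.range_comp, Submodule.range_subtype, ← LinearMap.range_eq_map, ← pow_succ']

lemma aux_mul_zero {k V : Type*} [Field k] [AddCommGroup V] [Module k V] (b : Fin 6 → V)
    (i j l : Fin 6) (h : ¬ (i ≠ j ∧ i ≠ l ∧ j ≠ l)) :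
    ι k (b i) * (ι k (b j) * ι k (b l)) = 0 := by
  have := aux_prod3 (k := k) ![b i, b j, b l]
  simp only [Matrix.cons_val] at this
  rw [← mul_assoc, ← this]
  apply ιMulti_eq_zero_of_not_inj
  intro hinj
  apply h
  refine ⟨?_, ?_, ?_⟩ <;> rintro rfl
  · exact absurd (@hinj 0 1 rfl) (by decide)
  · exact absurd (@hinj 0 2 rfl) (by decide)
  · exact absurd (@hinj 1 2 rfl) (by decide)

/-- Let `V₆` be a 6-dimensional vector space and `A ⊆ Λ³V₆` a Lagrangian
subspace for the wedge-product symplectic form. Let `V₃ ⊆ V₆` be 3-dimensional with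
annihilator `V₃^⊥ ⊆ V₆^∨`. Let `P` be the natural pairing `Λ³V₆ × Λ³(V₆^∨) → k` and `g` the
isomorphism `Λ³V₆ → Λ³(V₆^∨)` induced by the symplectic form (`P(η, g ξ) = φ(ξ∧η)` for a
trivialization `φ` of `Λ⁶V₆`). Then: the pairing between `V₆ ∧ Λ²V₃` and
`V₆^∨ ∧ Λ²(V₃^⊥)` is identically zero; `g` maps `V₆ ∧ Λ²V₃` onto `V₆^∨ ∧ Λ²(V₃^⊥)`; and
`A ∩ (V₆ ∧ Λ²V₃) ≠ 0` if and only if `A^⊥ ∩ (V₆^∨ ∧ Λ²(V₃^⊥)) ≠ 0`. -/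
theorem stmt_15 {k V : Type*} [Field k] [AddCommGroup V] [Module k V] [FiniteDimensional k V]
    (h6 : Module.finrank k V = 6)
    (V₃ : Submodule k V) (h3 : Module.finrank k V₃ = 3)
    (φ : ExteriorAlgebra k V →ₗ[k] k)
    (hφ : ∀ x ∈ ⋀[k]^6 V, φ x = 0 → x = 0)
    (P : ExteriorAlgebra k V →ₗ[k] ExteriorAlgebra k (Module.Dual k V) →ₗ[k] k)
    (hP : ∀ (v : Fin 3 → V) (f : Fin 3 → Module.Dual k V),
      P (ExteriorAlgebra.ι k (v 0) * ExteriorAlgebra.ι k (v 1) * ExteriorAlgebra.ι k (v 2))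
        (ExteriorAlgebra.ι k (f 0) * ExteriorAlgebra.ι k (f 1) * ExteriorAlgebra.ι k (f 2))
        = Matrix.det (Matrix.of fun i j => f i (v j)))
    (g : ExteriorAlgebra k V →ₗ[k] ExteriorAlgebra k (Module.Dual k V))
    (hg : ∀ ξ ∈ ⋀[k]^3 V, g ξ ∈ ⋀[k]^3 (Module.Dual k V) ∧
      ∀ η ∈ ⋀[k]^3 V, P η (g ξ) = φ (ξ * η))
    (A : Submodule k (ExteriorAlgebra k V)) (hA3 : A ≤ ⋀[k]^3 V)
    (hA10 : Module.finrank k A = 10)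
    (hLag : ∀ ξ ∈ A, ∀ η ∈ A, ξ * η = 0) :
    (∀ ξ ∈ (LinearMap.range (ExteriorAlgebra.ι k (M := V))) *
        (LinearMap.range ((ExteriorAlgebra.ι k).comp V₃.subtype)) ^ 2,
      ∀ η ∈ (LinearMap.range (ExteriorAlgebra.ι k (M := Module.Dual k V))) *
        (LinearMap.range ((ExteriorAlgebra.ι k).comp V₃.dualAnnihilator.subtype)) ^ 2,
      P ξ η = 0) ∧
    Submodule.map g
        ((LinearMap.range (ExteriorAlgebra.ι k (M := V))) *
          (LinearMap.range ((ExteriorAlgebra.ι k).comp V₃.subtype)) ^ 2)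
      = (LinearMap.range (ExteriorAlgebra.ι k (M := Module.Dual k V))) *
          (LinearMap.range ((ExteriorAlgebra.ι k).comp V₃.dualAnnihilator.subtype)) ^ 2 ∧
    (A ⊓ (LinearMap.range (ExteriorAlgebra.ι k (M := V))) *
        (LinearMap.range ((ExteriorAlgebra.ι k).comp V₃.subtype)) ^ 2 ≠ ⊥ ↔
      ((⋀[k]^3 (Module.Dual k V)) ⊓ ⨅ ξ : A, LinearMap.ker (P ξ)) ⊓
        (LinearMap.range (ExteriorAlgebra.ι k (M := Module.Dual k V))) *
          (LinearMap.range ((ExteriorAlgebra.ι k).comp V₃.dualAnnihilator.subtype)) ^ 2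
        ≠ ⊥) := by
  have hP' : ∀ (v : Fin 3 → V) (f : Fin 3 → Module.Dual k V),
      P (ιMulti k 3 v) (ιMulti k 3 f) = Matrix.det (Matrix.of fun i j => f i (v j)) := by
    intro v f
    rw [aux_prod3, aux_prod3, hP]
  obtain ⟨b, hV, hVd⟩ := aux_basis h6 V₃ h3
  have hcs : Submodule.span k (Set.range b.coord) = ⊤ := by
    rw [← b.coe_dualBasis]; exact b.dualBasis.span_eq
  have hF := aux_span b b.span_eq V₃ (fun i => i < 3) hV
  have hF' := aux_span b.coord hcs V₃.dualAnnihilator (fun i => 3 ≤ i) hVd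
  have hL := aux_span3 (k := k) b b.span_eq
  have hL' := aux_span3 (k := k) b.coord hcs
  have hgp := aux_gperm b φ hφ P hP' g hg
  set F := (LinearMap.range (ExteriorAlgebra.ι k (M := V))) *
        (LinearMap.range ((ExteriorAlgebra.ι k).comp V₃.subtype)) ^ 2 with hFdef
  set F' := (LinearMap.range (ExteriorAlgebra.ι k (M := Module.Dual k V))) *
        (LinearMap.range ((ExteriorAlgebra.ι k).comp V₃.dualAnnihilator.subtype)) ^ 2 with hFdef'
  have hFL : F ≤ ⋀[k]^3 V := by
    rw [hF, hL]
    apply Submodule.span_mono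
    rintro x ⟨i, j, l, _, _, rfl⟩
    exact ⟨i, j, l, trivial, trivial, rfl⟩
  have part1 : ∀ ξ ∈ F, ∀ η ∈ F', P ξ η = 0 := by
    intro ξ hξ η hη
    have h1 : F ≤ LinearMap.ker (P.flip η) := by
      rw [hF, Submodule.span_le]
      rintro _ ⟨i, j, l, hj, hl, rfl⟩
      have h2 : F' ≤ LinearMap.ker (P (ι k (b i) * (ι k (b j) * ι k (b l)))) := by
        rw [hF', Submodule.span_le]
        rintro _ ⟨i', j', l', hj', hl', rfl⟩
        have := hP ![b i, b j, b l] ![b.coord i', b.coord j', b.coord l']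
        simp only [Matrix.cons_val] at this
        rw [SetLike.mem_coe, LinearMap.mem_ker, ← mul_assoc, ← mul_assoc, this]
        have hz : ∀ x y : Fin 6, x < 3 → 3 ≤ y → b.coord y (b x) = 0 := by
          intro x y hx hy
          rw [Basis.coord_apply, Basis.repr_self, Finsupp.single_apply, if_neg]
          rintro rfl
          exact absurd hx (not_lt.mpr hy)
        rw [Matrix.det_fin_three]
        simp only [Matrix.of_apply, Matrix.cons_val]
        rw [hz j j' hj hj', hz j l' hj hl', hz l j' hl hj', hz l l' hl hl']
        ring
      exact h2 hη
    exact h1 hξ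
  have part2 : Submodule.map g F = F' := by
    apply le_antisymm
    · rw [Submodule.map_le_iff_le_comap, hF, Submodule.span_le]
      rintro _ ⟨i, j, l, hj, hl, rfl⟩
      rw [SetLike.mem_coe, Submodule.mem_comap]
      by_cases hd : i ≠ j ∧ i ≠ l ∧ j ≠ l
      · obtain ⟨x, y, z, -, hinj, hyz, -⟩ := aux_comb i j l hd.1 hd.2.1 hd.2.2
        obtain ⟨c, -, hc⟩ := hgp _ hinj
        simp only [Matrix.cons_val] at hc
        rw [hc, hF']
        exact Submodule.smul_mem _ _ (Submodule.subset_span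
          ⟨x, y, z, (hyz hj hl).1, (hyz hj hl).2, rfl⟩)
      · rw [aux_mul_zero b i j l hd, map_zero]
        exact zero_mem _
    · rw [hF', Submodule.span_le]
      rintro _ ⟨i, j, l, hj, hl, rfl⟩
      by_cases hd : i ≠ j ∧ i ≠ l ∧ j ≠ l
      · obtain ⟨x, y, z, hinj, -, -, hyz⟩ := aux_comb i j l hd.1 hd.2.1 hd.2.2
        obtain ⟨c, hc0, hc⟩ := hgp _ hinj
        simp only [Matrix.cons_val] at hc
        rw [← inv_smul_smul₀ hc0 (ι k (b.coord i) * _), ← hc]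
        refine Submodule.smul_mem _ _ (Submodule.mem_map_of_mem ?_)
        rw [hF]
        exact Submodule.subset_span ⟨x, y, z, (hyz hj hl).1, (hyz hj hl).2, rfl⟩
      · rw [aux_mul_zero b.coord i j l hd]
        exact zero_mem _
  have hsurj : ⋀[k]^3 (Dual k V) ≤ Submodule.map g (⋀[k]^3 V) := by
    rw [hL', Submodule.span_le]
    rintro _ ⟨i, j, l, -, -, rfl⟩
    by_cases hd : i ≠ j ∧ i ≠ l ∧ j ≠ l
    · obtain ⟨x, y, z, hinj, -, -, -⟩ := aux_comb i j l hd.1 hd.2.1 hd.2.2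
      obtain ⟨c, hc0, hc⟩ := hgp _ hinj
      simp only [Matrix.cons_val] at hc
      rw [← inv_smul_smul₀ hc0 (ι k (b.coord i) * _), ← hc]
      refine Submodule.smul_mem _ _ (Submodule.mem_map_of_mem ?_)
      rw [hL]
      exact Submodule.subset_span ⟨x, y, z, trivial, trivial, rfl⟩
    · rw [aux_mul_zero b.coord i j l hd]
      exact zero_mem _
  have hfr : finrank k (⋀[k]^3 V) = 20 := by
    rw [exteriorPower.finrank_eq, h6]; rfl
  have hfr' : finrank k (⋀[k]^3 (Dual k V)) = 20 := by
    rw [exteriorPower.finrank_eq, Subspace.dual_finrank_eq, h6]; rfl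
  let G : ⋀[k]^3 V →ₗ[k] ⋀[k]^3 (Dual k V) := g.restrict (fun x hx => (hg x hx).1)
  have hGs : Function.Surjective G := by
    rintro ⟨y, hy⟩
    obtain ⟨x, hx, rfl⟩ := hsurj hy
    exact ⟨⟨x, hx⟩, rfl⟩
  have hGi : Function.Injective G :=
    (LinearMap.injective_iff_surjective_of_finrank_eq_finrank (hfr.trans hfr'.symm)).mpr hGs
  have hinj : ∀ x ∈ ⋀[k]^3 V, g x = 0 → x = 0 := by
    intro x hx h0
    have : (⟨x, hx⟩ : ⋀[k]^3 V) = 0 := by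
      apply hGi
      rw [map_zero]
      exact Subtype.ext h0
    exact congrArg Subtype.val this
  have hmax : ∀ x ∈ ⋀[k]^3 V, (∀ a ∈ A, φ (x * a) = 0) → x ∈ A := by
    intro x hx hxa
    let B₀ : LinearMap.BilinForm k (⋀[k]^3 V) :=
      ((LinearMap.mul k (ExteriorAlgebra k V)).compr₂ φ).compl₁₂
        (Submodule.subtype _) (Submodule.subtype _)
    have hB₀ : ∀ m n, B₀ m n = φ (m.1 * n.1) := fun m n => rfl
    have hker : LinearMap.ker B₀ = ⊥ := by
      rw [LinearMap.ker_eq_bot']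
      intro m hm
      apply Subtype.ext
      apply hinj _ m.2
      apply aux_nondeg b P hP' _ (hg _ m.2).1
      intro v
      have hv : ιMulti k 3 v ∈ ⋀[k]^3 V := ιMulti_range k 3 ⟨v, rfl⟩
      rw [(hg _ m.2).2 _ hv]
      exact LinearMap.congr_fun hm ⟨_, hv⟩
    have hnd : B₀.Nondegenerate := LinearMap.BilinForm.nondegenerate_iff_ker_eq_bot.mpr hker
    let A' := A.submoduleOf (⋀[k]^3 V)
    have hA' : finrank k A' = 10 := by
      rw [← hA10]
      exact (Submodule.submoduleOfEquivOfLe hA3).finrank_eq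
    have hle : A' ≤ LinearMap.BilinForm.orthogonal (LinearMap.BilinForm.flip B₀) A' := by
      intro m hm n hn
      change φ (m.1 * n.1) = 0
      have h0 : m.1 * n.1 = 0 := hLag _ hm _ hn
      rw [h0, map_zero]
    have heq := Submodule.eq_of_le_of_finrank_eq hle (by
      rw [LinearMap.BilinForm.finrank_orthogonal hnd.flip, hfr, hA'])
    have : (⟨x, hx⟩ : ⋀[k]^3 V) ∈ A' := by
      rw [heq]
      intro n hn
      exact hxa _ hn
    exact this
  refine ⟨part1, part2, ?_⟩
  rw [Submodule.ne_bot_iff, Submodule.ne_bot_iff]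
  constructor
  · rintro ⟨x, ⟨hxA, hxF⟩, hx0⟩
    refine ⟨g x, ⟨⟨(hg x (hA3 hxA)).1, ?_⟩, ?_⟩, fun h => hx0 (hinj x (hA3 hxA) h)⟩
    · rw [SetLike.mem_coe, Submodule.mem_iInf]
      intro a
      rw [LinearMap.mem_ker, (hg x (hA3 hxA)).2 _ (hA3 a.2), hLag _ hxA _ a.2, map_zero]
    · rw [← part2]
      exact Submodule.mem_map_of_mem hxF
  · rintro ⟨y, ⟨⟨hy3, hyA⟩, hyF⟩, hy0⟩
    rw [← part2] at hyF
    obtain ⟨x, hxF, rfl⟩ := hyF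
    refine ⟨x, ⟨hmax x (hFL hxF) ?_, hxF⟩, ?_⟩
    · intro a ha
      rw [← (hg x (hFL hxF)).2 a (hA3 ha)]
      rw [SetLike.mem_coe, Submodule.mem_iInf] at hyA
      exact hyA ⟨a, ha⟩
    · rintro rfl
      exact hy0 (map_zero g)
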